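/- arXiv:1007.3562 — 4 statements merged into one kernel-verified Lean document; each statement's English description precedes it below -/
import Mathlib

section
/- In the braid group B₄, the product of the seven factors (c⁻²b)a(c⁻²b)⁻¹ · b · (ac³)b(ac³)⁻¹ · (ac⁵b⁻¹)a(ac⁵b⁻¹)⁻¹ · c · c · a³ba⁻³ is equal to the product of the seven factors b · (ac)b(ac)⁻¹ · (ac)b(ac)⁻¹ · (ac)²b(ac)⁻² · (ac)²b(ac)⁻² · (ac)³b(ac)⁻³ · a³ba⁻³. In other words, the two factorizations given in the paper are factorizations of the same braid. -/
/-- The Artin relations for the braid group B₄ on generators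
`a = of 0`, `b = of 1`, `c = of 2`: `aba = bab`, `bcb = cbc`, `ac = ca`. -/
def braidRels4 : Set (FreeGroup (Fin 3)) :=
  {FreeGroup.of 0 * FreeGroup.of 1 * FreeGroup.of 0 *
      (FreeGroup.of 1 * FreeGroup.of 0 * FreeGroup.of 1)⁻¹,
   FreeGroup.of 1 * FreeGroup.of 2 * FreeGroup.of 1 *
      (FreeGroup.of 2 * FreeGroup.of 1 * FreeGroup.of 2)⁻¹,
   FreeGroup.of 0 * FreeGroup.of 2 * (FreeGroup.of 2 * FreeGroup.of 0)⁻¹}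

/-- The braid group B₄. -/
abbrev B4 : Type := PresentedGroup braidRels4

def B4.a : B4 := PresentedGroup.of 0
def B4.b : B4 := PresentedGroup.of 1
def B4.c : B4 := PresentedGroup.of 2

/-- An identity between two positive words of length 15 in the braid monoid on four strands. -/
theorem braid_positive_word_eq {G : Type*} [Group G] {a b c : G}
    (hab : a * b * a = b * a * b) (hbc : b * c * b = c * b * c) (hac : a * c = c * a) :
    b * a * c * c * b * a * c * c * c * b * c * c * a * b * a =
      a * c * c * b * a * c * b * b * a * c * b * b * a * c * b := by
  calc b * a * c * c * b * a * c * c * c * b * c * c * a * b * a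
    _ = b * a * c * c * b * a * c * c * c * b * c * c * b * a * b := by
      simpa only [mul_assoc] using
        congrArg (fun g => b * a * c * c * b * a * c * c * c * b * c * c * g) hab
    _ = b * a * c * c * b * c * a * c * c * b * c * c * b * a * b := by
      simpa only [mul_assoc] using
        congrArg (fun g => b * a * c * c * b * g * c * c * b * c * c * b * a * b) hac
    _ = b * a * c * b * c * b * a * c * c * b * c * c * b * a * b := by
      simpa only [mul_assoc] using
        congrArg (fun g => b * a * c * g * a * c * c * b * c * c * b * a * b) hbc.symm
    _ = b * a * b * c * b * b * a * c * c * b * c * c * b * a * b := by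
      simpa only [mul_assoc] using
        congrArg (fun g => b * a * g * b * a * c * c * b * c * c * b * a * b) hbc.symm
    _ = a * b * a * c * b * b * a * c * c * b * c * c * b * a * b := by
      simpa only [mul_assoc] using
        congrArg (fun g => g * c * b * b * a * c * c * b * c * c * b * a * b) hab.symm
    _ = a * b * c * a * b * b * a * c * c * b * c * c * b * a * b := by
      simpa only [mul_assoc] using
        congrArg (fun g => a * b * g * b * b * a * c * c * b * c * c * b * a * b) hac
    _ = a * b * c * a * b * b * a * c * b * c * b * c * b * a * b := by
      simpa only [mul_assoc] using
        congrArg (fun g => a * b * c * a * b * b * a * c * g * c * b * a * b) hbc.symm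
    _ = a * b * c * a * b * b * a * c * b * c * c * b * c * a * b := by
      simpa only [mul_assoc] using
        congrArg (fun g => a * b * c * a * b * b * a * c * b * c * g * a * b) hbc
    _ = a * b * c * a * b * b * a * b * c * b * c * b * c * a * b := by
      simpa only [mul_assoc] using
        congrArg (fun g => a * b * c * a * b * b * a * g * c * b * c * a * b) hbc.symm
    _ = a * b * c * a * b * a * b * a * c * b * c * b * c * a * b := by
      simpa only [mul_assoc] using
        congrArg (fun g => a * b * c * a * b * g * c * b * c * b * c * a * b) hab.symm
    _ = a * b * c * b * a * b * b * a * c * b * c * b * c * a * b := by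
      simpa only [mul_assoc] using
        congrArg (fun g => a * b * c * g * b * a * c * b * c * b * c * a * b) hab
    _ = a * c * b * c * a * b * b * a * c * b * c * b * c * a * b := by
      simpa only [mul_assoc] using
        congrArg (fun g => a * g * a * b * b * a * c * b * c * b * c * a * b) hbc
    _ = a * c * b * c * a * b * b * a * b * c * b * b * c * a * b := by
      simpa only [mul_assoc] using
        congrArg (fun g => a * c * b * c * a * b * b * a * g * b * c * a * b) hbc.symm
    _ = a * c * b * c * a * b * a * b * a * c * b * b * c * a * b := by
      simpa only [mul_assoc] using
        congrArg (fun g => a * c * b * c * a * b * g * c * b * b * c * a * b) hab.symm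
    _ = a * c * b * c * b * a * b * b * a * c * b * b * c * a * b := by
      simpa only [mul_assoc] using
        congrArg (fun g => a * c * b * c * g * b * a * c * b * b * c * a * b) hab
    _ = a * c * c * b * c * a * b * b * a * c * b * b * c * a * b := by
      simpa only [mul_assoc] using
        congrArg (fun g => a * c * g * a * b * b * a * c * b * b * c * a * b) hbc
    _ = a * c * c * b * a * c * b * b * a * c * b * b * c * a * b := by
      simpa only [mul_assoc] using
        congrArg (fun g => a * c * c * b * g * b * b * a * c * b * b * c * a * b) hac.symm
    _ = a * c * c * b * a * c * b * b * a * c * b * b * a * c * b := by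
      simpa only [mul_assoc] using
        congrArg (fun g => a * c * c * b * a * c * b * b * a * c * b * b * g * b) hac.symm

theorem B4.a_b_a : B4.a * B4.b * B4.a = B4.b * B4.a * B4.b :=
  PresentedGroup.mk_eq_mk_of_mul_inv_mem (rels := braidRels4) (by simp [braidRels4])

theorem B4.b_c_b : B4.b * B4.c * B4.b = B4.c * B4.b * B4.c :=
  PresentedGroup.mk_eq_mk_of_mul_inv_mem (rels := braidRels4) (by simp [braidRels4])

theorem B4.a_c : B4.a * B4.c = B4.c * B4.a :=
  PresentedGroup.mk_eq_mk_of_mul_inv_mem (rels := braidRels4) (by simp [braidRels4])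

open B4 in
/-- The two factorizations from the paper are factorizations of the same braid in B₄. -/
theorem same_braid :
    ((c^2)⁻¹ * b) * a * ((c^2)⁻¹ * b)⁻¹ * b * ((a * c^3) * b * (a * c^3)⁻¹) *
      ((a * c^5 * b⁻¹) * a * (a * c^5 * b⁻¹)⁻¹) * c * c * (a^3 * b * (a^3)⁻¹)
    =
    b * ((a * c) * b * (a * c)⁻¹) * ((a * c) * b * (a * c)⁻¹) *
      ((a * c)^2 * b * ((a * c)^2)⁻¹) * ((a * c)^2 * b * ((a * c)^2)⁻¹) *
      ((a * c)^3 * b * ((a * c)^3)⁻¹) * (a^3 * b * (a^3)⁻¹) := by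
  have key := braid_positive_word_eq a_b_a b_c_b a_c
  have hac : Commute a c := a_c
  have h₁ : b * a * b⁻¹ = a⁻¹ * b * a := by
    rw [mul_inv_eq_iff_eq_mul, mul_assoc, mul_assoc, eq_inv_mul_iff_mul_eq]
    simpa only [mul_assoc] using a_b_a
  have h₂ : b⁻¹ * a * b = a * b * a⁻¹ := by
    rw [eq_mul_inv_iff_mul_eq, mul_assoc, mul_assoc, inv_mul_eq_iff_eq_mul]
    simpa only [mul_assoc] using a_b_a
  have h₃ : (c ^ 5)⁻¹ * a⁻¹ * c * c = a⁻¹ * (c ^ 3)⁻¹ := by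
    rw [← mul_inv_rev, (hac.pow_right 5).eq]
    group
  have h₄ : (c ^ 3)⁻¹ * a⁻¹ * a * c ^ 5 = c ^ 2 := by group
  have h₅ : a⁻¹ * a⁻¹ * a⁻¹ * (c ^ 3)⁻¹ = ((a * c) ^ 3)⁻¹ := by
    rw [hac.mul_pow, (hac.pow_pow 3 3).eq]
    group
  congr 1
  calc
    _ = (c ^ 2)⁻¹ * (b * a * b⁻¹) * c ^ 2 * b * a * c ^ 3 * b *
          ((c ^ 3)⁻¹ * a⁻¹ * a * c ^ 5) * (b⁻¹ * a * b) *
          ((c ^ 5)⁻¹ * a⁻¹ * c * c) := by group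
    _ = (c ^ 2)⁻¹ * a⁻¹ *
          (b * a * c * c * b * a * c * c * c * b * c * c * a * b * a) *
          (a⁻¹ * a⁻¹ * a⁻¹ * (c ^ 3)⁻¹) := by
        rw [h₁, h₂, h₃, h₄]
        simp only [pow_succ, pow_zero, one_mul, mul_assoc, mul_inv_cancel_left]
    _ = _ := by
        rw [key, h₅]
        simp only [pow_succ, pow_zero, one_mul, mul_assoc, mul_inv_rev, inv_mul_cancel_left]
end

section
/- The presented group G₁ on four generators x₁, x₂, x₃, x₄ subject to the relations x₂ = x₃, x₃ = x₄, and x₁ = x₂⁻¹x₄x₃x₄⁻¹x₂ is isomorphic to the infinite cyclic group ℤ. -/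
/-- The relations of the presented group G₁ = ⟨x₁,x₂,x₃,x₄ | x₂x₃⁻¹, x₃x₄⁻¹,
x₁(x₂⁻¹x₄x₃x₄⁻¹x₂)⁻¹⟩, with xᵢ = of (i-1). -/
def G1rels : Set (FreeGroup (Fin 4)) :=
  {FreeGroup.of 1 * (FreeGroup.of 2)⁻¹,
   FreeGroup.of 2 * (FreeGroup.of 3)⁻¹,
   FreeGroup.of 0 *
     ((FreeGroup.of 1)⁻¹ * FreeGroup.of 3 * FreeGroup.of 2 * (FreeGroup.of 3)⁻¹ *
        FreeGroup.of 1)⁻¹}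

theorem G1rels_of_eq_of_one (i : Fin 4) :
    (PresentedGroup.of i : PresentedGroup G1rels) = PresentedGroup.of 1 := by
  have h12 : (PresentedGroup.of 1 : PresentedGroup G1rels) = PresentedGroup.of 2 :=
    PresentedGroup.mk_eq_mk_of_mul_inv_mem (by simp [G1rels])
  have h23 : (PresentedGroup.of 2 : PresentedGroup G1rels) = PresentedGroup.of 3 :=
    PresentedGroup.mk_eq_mk_of_mul_inv_mem (by simp [G1rels])
  have h0 : (PresentedGroup.of 0 : PresentedGroup G1rels) =
      (PresentedGroup.of 1)⁻¹ * PresentedGroup.of 3 * PresentedGroup.of 2 *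
        (PresentedGroup.of 3)⁻¹ * PresentedGroup.of 1 :=
    PresentedGroup.mk_eq_mk_of_mul_inv_mem (by simp [G1rels])
  rw [← h23, ← h12] at h0
  fin_cases i
  · simpa using h0
  · rfl
  · exact h12.symm
  · exact (h12.trans h23).symm

theorem lift_ofAdd_one_eq_one_of_mem_G1rels :
    ∀ r ∈ G1rels, FreeGroup.lift (fun _ : Fin 4 => Multiplicative.ofAdd (1 : ℤ)) r = 1 := by
  rintro r (rfl | rfl | rfl) <;> simp

/-- The group G₁ = π₁(D⁴ ∖ S₁) is isomorphic to the infinite cyclic group ℤ. -/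
theorem G1_iso_int : Nonempty (PresentedGroup G1rels ≃* Multiplicative ℤ) := by
  refine ⟨MonoidHom.toMulEquiv (PresentedGroup.toGroup lift_ofAdd_one_eq_one_of_mem_G1rels)
    (zpowersHom _ (PresentedGroup.of 1)) ?_ ?_⟩
  · ext i
    simp [G1rels_of_eq_of_one i]
  · ext
    simp
end

section
/- The presented group G₂ on four generators x₁, x₂, x₃, x₄ subject to the relations x₂ = x₃, x₁ = x₃⁻¹x₄x₃, and x₃ = x₁⁻¹x₂⁻¹x₁x₂x₁ is isomorphic to the braid group B₃. -/
/-- The relations of the presented group G₂ = ⟨x₁,x₂,x₃,x₄ | x₂x₃⁻¹, x₁(x₃⁻¹x₄x₃)⁻¹,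
x₃(x₁⁻¹x₂⁻¹x₁x₂x₁)⁻¹⟩, with xᵢ = of (i-1). -/
def G2rels : Set (FreeGroup (Fin 4)) :=
  {FreeGroup.of 1 * (FreeGroup.of 2)⁻¹,
   FreeGroup.of 0 * ((FreeGroup.of 2)⁻¹ * FreeGroup.of 3 * FreeGroup.of 2)⁻¹,
   FreeGroup.of 2 *
     ((FreeGroup.of 0)⁻¹ * (FreeGroup.of 1)⁻¹ * FreeGroup.of 0 * FreeGroup.of 1 *
        FreeGroup.of 0)⁻¹}

/-- The Artin relation for the braid group B₃ on generators `u = of 0`, `v = of 1`: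
`uvu = vuv`. -/
def braidRels3 : Set (FreeGroup (Fin 2)) :=
  {FreeGroup.of 0 * FreeGroup.of 1 * FreeGroup.of 0 *
     (FreeGroup.of 1 * FreeGroup.of 0 * FreeGroup.of 1)⁻¹}

/-- The braid group B₃. -/
abbrev B3 : Type := PresentedGroup braidRels3

/-- The commutator-like form of the braid relation appearing in `G2rels`. -/
theorem eq_inv_mul_inv_mul_iff_braid {G : Type*} [Group G] {a b : G} :
    b = a⁻¹ * b⁻¹ * a * b * a ↔ a * b * a = b * a * b := by
  constructor
  · intro h
    calc a * b * a = b * a * (a⁻¹ * b⁻¹ * a * b * a) := by group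
      _ = b * a * b := by rw [← h]
  · intro h
    have h' : a⁻¹ * b⁻¹ * a * b * a = a⁻¹ * b⁻¹ * (a * b * a) := by group
    rw [h', h]
    group

namespace B3

theorem braid_relation :
    (PresentedGroup.of 0 * PresentedGroup.of 1 * PresentedGroup.of 0 : B3) =
      PresentedGroup.of 1 * PresentedGroup.of 0 * PresentedGroup.of 1 :=
  PresentedGroup.mk_eq_mk_of_mul_inv_mem (Set.mem_singleton _)

end B3

namespace G2

theorem of_one_eq_of_two :
    (PresentedGroup.of 1 : PresentedGroup G2rels) = PresentedGroup.of 2 :=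
  PresentedGroup.mk_eq_mk_of_mul_inv_mem (Or.inl rfl)

theorem of_zero_eq :
    (PresentedGroup.of 0 : PresentedGroup G2rels) =
      (PresentedGroup.of 2)⁻¹ * PresentedGroup.of 3 * PresentedGroup.of 2 :=
  PresentedGroup.mk_eq_mk_of_mul_inv_mem (Or.inr (Or.inl rfl))

theorem of_two_eq :
    (PresentedGroup.of 2 : PresentedGroup G2rels) =
      (PresentedGroup.of 0)⁻¹ * (PresentedGroup.of 1)⁻¹ * PresentedGroup.of 0 *
        PresentedGroup.of 1 * PresentedGroup.of 0 :=
  PresentedGroup.mk_eq_mk_of_mul_inv_mem (Or.inr (Or.inr rfl))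

theorem braid_relation :
    (PresentedGroup.of 0 * PresentedGroup.of 1 * PresentedGroup.of 0 : PresentedGroup G2rels) =
      PresentedGroup.of 1 * PresentedGroup.of 0 * PresentedGroup.of 1 :=
  eq_inv_mul_inv_mul_iff_braid.1 (of_one_eq_of_two.trans of_two_eq)

/-- The images in `B3` of the four generators of `G₂`. -/
def generatorImage : Fin 4 → B3 :=
  ![PresentedGroup.of 0, PresentedGroup.of 1, PresentedGroup.of 1,
    PresentedGroup.of 1 * PresentedGroup.of 0 * (PresentedGroup.of 1)⁻¹]

theorem lift_generatorImage_eq_one :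
    ∀ r ∈ G2rels, FreeGroup.lift generatorImage r = 1 := by
  rintro r (rfl | rfl | rfl)
  · simp [generatorImage]
  · simp [generatorImage, mul_assoc]
  · simpa [generatorImage, mul_inv_eq_one, -mul_inv_rev] using
      eq_inv_mul_inv_mul_iff_braid.2 B3.braid_relation

/-- The homomorphism from `G₂` to the braid group on three strands. -/
def toB3 : PresentedGroup G2rels →* B3 :=
  PresentedGroup.toGroup lift_generatorImage_eq_one

/-- The images in `G₂` of the two Artin generators. -/
def artinImage : Fin 2 → PresentedGroup G2rels :=
  ![PresentedGroup.of 0, PresentedGroup.of 1]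

theorem lift_artinImage_eq_one :
    ∀ r ∈ braidRels3, FreeGroup.lift artinImage r = 1 := by
  rintro r rfl
  simpa [artinImage, mul_inv_eq_one, -mul_inv_rev] using braid_relation

/-- The homomorphism from the braid group on three strands to `G₂`. -/
def ofB3 : B3 →* PresentedGroup G2rels :=
  PresentedGroup.toGroup lift_artinImage_eq_one

theorem ofB3_comp_toB3 : ofB3.comp toB3 = MonoidHom.id _ := by
  ext x
  fin_cases x
  · simp [ofB3, toB3, generatorImage, artinImage]
  · simp [ofB3, toB3, generatorImage, artinImage]
  · simp [ofB3, toB3, generatorImage, artinImage, of_one_eq_of_two]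
  · simp [ofB3, toB3, generatorImage, artinImage, of_one_eq_of_two, of_zero_eq, mul_assoc]

theorem toB3_comp_ofB3 : toB3.comp ofB3 = MonoidHom.id _ := by
  ext x
  fin_cases x <;> simp [ofB3, toB3, generatorImage, artinImage]

end G2

/-- The group G₂ = π₁(D⁴ ∖ S₂) is isomorphic to the braid group B₃. -/
theorem G2_iso_B3 : Nonempty (PresentedGroup G2rels ≃* B3) :=
  ⟨G2.toB3.toMulEquiv G2.ofB3 G2.ofB3_comp_toB3 G2.toB3_comp_ofB3⟩
end

section
/- Let H = φ⁻¹(2ℤ) be the subgroup of B₃ consisting of elements g with φ(g) even, where φ : B₃ → ℤ sends both generators u, v to 1. The element u² lies in H, and the homomorphism ψ : B₃ → S₃ (with u ↦ (1 2), v ↦ (2 3)) sends u² to the identity. Hence ψ restricted to H descends to a surjective homomorphism from the quotient of H by the normal closure (in H) of u² onto the alternating group A₃ ≅ ℤ/3ℤ; in particular this quotient group, which is π₁(M₂), is nontrivial. -/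
/-- The subgroup H = φ⁻¹(2ℤ) of B₃, consisting of elements whose image under φ is even. -/
def evenSubgroup (φ : B3 →* Multiplicative ℤ) : Subgroup B3 :=
  Subgroup.comap φ (Subgroup.zpowers (Multiplicative.ofAdd (2 : ℤ)))

/-- A homomorphism `ψ : B₃ → S₃` sending generators to odd permutations sends elements of even
exponent sum to even permutations. -/
theorem sign_eq_one_of_mem_evenSubgroup {φ : B3 →* Multiplicative ℤ}
    {ψ : B3 →* Equiv.Perm (Fin 3)}
    (hφ : ∀ i, φ (PresentedGroup.of i) = Multiplicative.ofAdd 1)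
    (hψ : ∀ i, Equiv.Perm.sign (ψ (PresentedGroup.of i)) = -1)
    {g : B3} (hg : g ∈ evenSubgroup φ) : Equiv.Perm.sign (ψ g) = 1 := by
  have key : Equiv.Perm.sign.comp ψ = (zpowersHom ℤˣ (-1)).comp φ := by
    apply PresentedGroup.ext
    intro i
    simp [hφ, hψ]
  obtain ⟨k, hk⟩ := Subgroup.mem_zpowers_iff.mp (Subgroup.mem_comap.mp hg)
  have h : Equiv.Perm.sign (ψ g) = zpowersHom ℤˣ (-1) (φ g) := DFunLike.congr_fun key g
  have hsq : zpowersHom ℤˣ (-1) (Multiplicative.ofAdd 2) = 1 := by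
    rw [zpowersHom_apply]
    rfl
  rw [h, ← hk, map_zpow, hsq, one_zpow]

/-- Every even permutation of three letters is a power of a 3-cycle. -/
theorem exists_pow_of_sign_eq_one (σ : Equiv.Perm (Fin 3)) (h : Equiv.Perm.sign σ = 1) :
    ∃ k : Fin 3, (Equiv.swap 0 1 * Equiv.swap 1 2) ^ (k : ℕ) = σ := by
  revert σ
  decide

/-- With φ : B₃ → ℤ sending u, v ↦ 1 and ψ : B₃ → S₃ sending u ↦ (1 2), v ↦ (2 3):
u² lies in H = φ⁻¹(2ℤ), ψ(u²) = 1, and ψ|H descends to a homomorphism from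
π₁(M₂) = H / ⟪u²⟫ onto the alternating group A₃ ≅ ℤ/3; in particular this quotient
is nontrivial. -/
theorem pi1_M2_nontrivial (φ : B3 →* Multiplicative ℤ) (ψ : B3 →* Equiv.Perm (Fin 3))
    (hφu : φ (PresentedGroup.of 0) = Multiplicative.ofAdd 1)
    (hφv : φ (PresentedGroup.of 1) = Multiplicative.ofAdd 1)
    (hψu : ψ (PresentedGroup.of 0) = Equiv.swap 0 1)
    (hψv : ψ (PresentedGroup.of 1) = Equiv.swap 1 2) :
    ∃ hu : (PresentedGroup.of 0 : B3)^2 ∈ evenSubgroup φ,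
      ψ ((PresentedGroup.of 0 : B3)^2) = 1 ∧
      ∃ ρ : (evenSubgroup φ) ⧸ Subgroup.normalClosure
              ({⟨(PresentedGroup.of 0 : B3)^2, hu⟩} : Set (evenSubgroup φ)) →*
            Equiv.Perm (Fin 3),
        (∀ g : evenSubgroup φ, ρ (QuotientGroup.mk g) = ψ (g : B3)) ∧
        Set.range ρ = (alternatingGroup (Fin 3) : Set (Equiv.Perm (Fin 3))) ∧
        Nontrivial ((evenSubgroup φ) ⧸ Subgroup.normalClosure
          ({⟨(PresentedGroup.of 0 : B3)^2, hu⟩} : Set (evenSubgroup φ))) := by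
  have hφ : ∀ i, φ (PresentedGroup.of i) = Multiplicative.ofAdd 1 :=
    Fin.forall_fin_two.mpr ⟨hφu, hφv⟩
  have hψ : ∀ i, Equiv.Perm.sign (ψ (PresentedGroup.of i)) = -1 := by
    refine Fin.forall_fin_two.mpr ⟨?_, ?_⟩
    · rw [hψu]; decide
    · rw [hψv]; decide
  have hu : (PresentedGroup.of 0 : B3) ^ 2 ∈ evenSubgroup φ := by
    refine Subgroup.mem_comap.mpr (Subgroup.mem_zpowers_iff.mpr ⟨1, ?_⟩)
    rw [map_pow, hφu]
    rfl
  have huv : (PresentedGroup.of 0 * PresentedGroup.of 1 : B3) ∈ evenSubgroup φ := by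
    refine Subgroup.mem_comap.mpr (Subgroup.mem_zpowers_iff.mpr ⟨1, ?_⟩)
    rw [map_mul, hφu, hφv]
    rfl
  have hψu2 : ψ ((PresentedGroup.of 0 : B3) ^ 2) = 1 := by
    rw [map_pow, hψu]
    decide
  have hker : Subgroup.normalClosure
      ({⟨(PresentedGroup.of 0 : B3) ^ 2, hu⟩} : Set (evenSubgroup φ)) ≤
      (ψ.comp (evenSubgroup φ).subtype).ker :=
    Subgroup.normalClosure_le_normal (Set.singleton_subset_iff.mpr hψu2)
  let ρ := QuotientGroup.lift _ (ψ.comp (evenSubgroup φ).subtype) hker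
  have hρ : ∀ g : evenSubgroup φ, ρ (QuotientGroup.mk g) = ψ (g : B3) := fun _ => rfl
  have hψuv : ψ (PresentedGroup.of 0 * PresentedGroup.of 1) =
      Equiv.swap 0 1 * Equiv.swap 1 2 := by
    rw [map_mul, hψu, hψv]
  refine ⟨hu, hψu2, ρ, hρ, ?_, ?_⟩
  · ext σ
    rw [SetLike.mem_coe, Equiv.Perm.mem_alternatingGroup]
    constructor
    · rintro ⟨q, rfl⟩
      obtain ⟨g, rfl⟩ := QuotientGroup.mk_surjective q
      exact sign_eq_one_of_mem_evenSubgroup hφ hψ g.2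
    · intro hσ
      obtain ⟨k, rfl⟩ := exists_pow_of_sign_eq_one σ hσ
      refine ⟨QuotientGroup.mk (⟨_, huv⟩ ^ (k : ℕ)), ?_⟩
      rw [hρ, SubmonoidClass.coe_pow, map_pow, hψuv]
  · refine ⟨QuotientGroup.mk ⟨_, huv⟩, 1, fun h => ?_⟩
    have h1 := congrArg ρ h
    rw [hρ, map_one, hψuv] at h1
    revert h1
    decide
end
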